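/- arXiv:quant-ph/0608165 — 4 statements merged into one kernel-verified Lean document; each statement's English description precedes it below -/
import Mathlib

section
/- Lo's no-go theorem for one-sided two-party computation (key lemma): let H_A and H_B be finite-dimensional complex Hilbert spaces, n ≥ 1, let (e_i)_{i=1}^n be the standard orthonormal basis of ℂⁿ, let (a_i)_{i=1}^n be an orthonormal family in H_A, let j₁ and j₂ be unit vectors in H_B, and let U be a unitary operator on H_A ⊗ H_B. For j ∈ {j₁, j₂} define v_j = (1/√n) Σ_{i=1}^n e_i ⊗ U(a_i ⊗ j) ∈ ℂⁿ ⊗ H_A ⊗ H_B. If the reduced states on Alice's side agree, i.e. Tr_{H_B}|v_{j₁}⟩⟨v_{j₁}| = Tr_{H_B}|v_{j₂}⟩⟨v_{j₂}| as operators on ℂⁿ ⊗ H_A, then there exists a unitary V on H_B such that (id_{ℂⁿ ⊗ H_A} ⊗ V) v_{j₁} = v_{j₂}, and moreover this V is universal over Alice's inputs: for every i ∈ {1,…,n}, (id_{H_A} ⊗ V) U(a_i ⊗ j₁) = U(a_i ⊗ j₂). -/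
open Matrix Kronecker

/-- The elementary tensor `v ⊗ w` of two vectors, in coordinates. -/
noncomputable def tensorVec {m n : ℕ} (v : Fin m → ℂ) (w : Fin n → ℂ) :
    Fin m × Fin n → ℂ :=
  fun p => v p.1 * w p.2

/-- The rank-one projection `|ψ⟩⟨ψ|` onto the span of a vector `ψ`. -/
noncomputable def outerProj {ι : Type*} (ψ : ι → ℂ) : Matrix ι ι ℂ :=
  fun x y => ψ x * star (ψ y)

/-- The partial trace over the second tensor factor (Bob's side):
`⟨k, (Tr_B ρ) k'⟩ = Σ_b ⟨k ⊗ f_b, ρ (k' ⊗ f_b)⟩`. -/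
noncomputable def ptraceB {κ γ : Type*} [Fintype γ]
    (ρ : Matrix (κ × γ) (κ × γ) ℂ) : Matrix κ κ ℂ :=
  fun k k' => ∑ c : γ, ρ (k, c) (k', c)

/-- The global output `v_j = (1/√n) Σ_i e_i ⊗ U(a_i ⊗ j)` of a one-sided
two-party computation in which Alice entangles her input register `H_A`
(with inputs `a_i`) with a private dice register `ℂⁿ`, Bob inputs `j`, and
the protocol is the unitary `U` on `H_A ⊗ H_B`. It lives in `ℂⁿ ⊗ H_A ⊗ H_B`. -/
noncomputable def loOutput {n p q : ℕ} (U : Matrix (Fin p × Fin q) (Fin p × Fin q) ℂ)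
    (a : Fin n → (Fin p → ℂ)) (j : Fin q → ℂ) : (Fin n × Fin p) × Fin q → ℂ :=
  fun x => (1 / (Real.sqrt (n : ℝ) : ℂ)) * U.mulVec (tensorVec (a x.1.1) j) (x.1.2, x.2)

/-- Two finite families of vectors with the same Gram matrix are related by a linear isometry. -/
theorem exists_linearIsometry_of_inner_eq {κ E : Type*} [Fintype κ] [NormedAddCommGroup E]
    [InnerProductSpace ℂ E] [FiniteDimensional ℂ E] (x y : κ → E)
    (h : ∀ k k', inner ℂ (x k) (x k') = inner ℂ (y k) (y k')) :
    ∃ L : E →ₗᵢ[ℂ] E, ∀ k, L (x k) = y k := by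
  classical
  let f := Fintype.linearCombination ℂ x
  let g := Fintype.linearCombination ℂ y
  have hnorm : ∀ c, ‖f c‖ = ‖g c‖ := fun c => by
    rw [@norm_eq_sqrt_re_inner ℂ, @norm_eq_sqrt_re_inner ℂ]
    simp only [f, g, Fintype.linearCombination_apply, sum_inner, inner_sum, inner_smul_left,
      inner_smul_right, h]
  have hker : LinearMap.ker f ≤ LinearMap.ker g := fun c hc => by
    rw [LinearMap.mem_ker, ← norm_eq_zero] at hc ⊢
    rw [← hnorm, hc]
  let M : LinearMap.range f →ₗ[ℂ] E :=
    (LinearMap.ker f).liftQ g hker ∘ₗ f.quotKerEquivRange.symm.toLinearMap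
  have hM : ∀ c, M ⟨f c, LinearMap.mem_range_self f c⟩ = g c := fun c => by
    simp only [M, LinearMap.comp_apply, LinearEquiv.coe_coe]
    rw [LinearMap.quotKerEquivRange_symm_apply_image, Submodule.mkQ_apply, Submodule.liftQ_apply]
  let L : LinearMap.range f →ₗᵢ[ℂ] E :=
    { M with
      norm_map' := by
        rintro ⟨_, c, rfl⟩
        exact (congrArg norm (hM c)).trans (hnorm c).symm }
  refine ⟨L.extend, fun k => ?_⟩
  have hf : f (Pi.single k 1) = x k := by simp [f, Fintype.linearCombination_apply_single]
  have hg : g (Pi.single k 1) = y k := by simp [g, Fintype.linearCombination_apply_single]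
  rw [← hf, ← hg, ← hM]
  exact L.extend_apply ⟨_, LinearMap.mem_range_self f _⟩

/-- A linear isometry of a finite-dimensional coordinate space acts by a unitary matrix. -/
theorem LinearIsometry.exists_unitary_mulVec {γ : Type*} [Fintype γ] [DecidableEq γ]
    (L : EuclideanSpace ℂ γ →ₗᵢ[ℂ] EuclideanSpace ℂ γ) :
    ∃ V ∈ Matrix.unitaryGroup γ ℂ, ∀ z : γ → ℂ, V.mulVec z = (L (WithLp.toLp 2 z)).ofLp := by
  refine ⟨Matrix.of fun c c' => L (EuclideanSpace.single c' 1) c, ?_, fun z => ?_⟩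
  · rw [Matrix.mem_unitaryGroup_iff']
    ext i j
    have h := L.inner_map_map (EuclideanSpace.single i 1) (EuclideanSpace.single j 1)
    simpa [-LinearIsometry.inner_map_map, PiLp.inner_apply, Matrix.mul_apply, Matrix.star_apply,
      Matrix.one_apply, mul_comm, Pi.single_apply, eq_comm] using h
  · have hz : WithLp.toLp 2 z = ∑ c, z c • EuclideanSpace.single c (1 : ℂ) := by
      ext c
      simp [Pi.single_apply]
    rw [hz, map_sum]
    ext c
    simp [Matrix.mulVec, dotProduct, mul_comm]

/-- The action of `id ⊗ V` in coordinates. -/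
theorem one_kronecker_mulVec_apply {κ γ : Type*} [Fintype κ] [DecidableEq κ] [Fintype γ]
    (V : Matrix γ γ ℂ) (ψ : κ × γ → ℂ) (k : κ) (c : γ) :
    ((1 : Matrix κ κ ℂ) ⊗ₖ V).mulVec ψ (k, c) = V.mulVec (fun c' => ψ (k, c')) c := by
  simp [Matrix.mulVec, dotProduct, Fintype.sum_prod_type, Matrix.one_apply, ite_mul,
    Finset.sum_ite_irrel]

/-- Two purifications of the same reduced state differ by a unitary on the purifying system. -/
theorem exists_unitary_of_ptraceB_eq {κ γ : Type*} [Fintype κ] [DecidableEq κ] [Fintype γ]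
    [DecidableEq γ] (ψ φ : κ × γ → ℂ) (h : ptraceB (outerProj ψ) = ptraceB (outerProj φ)) :
    ∃ V ∈ Matrix.unitaryGroup γ ℂ, ((1 : Matrix κ κ ℂ) ⊗ₖ V).mulVec ψ = φ := by
  obtain ⟨L, hL⟩ := exists_linearIsometry_of_inner_eq
    (fun k => WithLp.toLp 2 fun c => ψ (k, c)) (fun k => WithLp.toLp 2 fun c => φ (k, c))
    (fun k k' => by simpa [PiLp.inner_apply, ptraceB, outerProj] using congrFun₂ h k' k)
  obtain ⟨V, hV, hVL⟩ := L.exists_unitary_mulVec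
  refine ⟨V, hV, ?_⟩
  ext ⟨k, c⟩
  rw [one_kronecker_mulVec_apply, hVL, hL]

/-- **Key lemma of Lo's no-go theorem for one-sided two-party computation.**
If the reduced states of `v_{j₁}` and `v_{j₂}` on Alice's side `ℂⁿ ⊗ H_A` agree,
then there is a unitary `V` on Bob's side `H_B` with `(id ⊗ V) v_{j₁} = v_{j₂}`,
and this `V` is universal over Alice's inputs:
`(id_{H_A} ⊗ V) U(a_i ⊗ j₁) = U(a_i ⊗ j₂)` for every `i`. -/
theorem lo_no_go_key_lemma (n p q : ℕ) (hn : 1 ≤ n)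
    (a : Fin n → (Fin p → ℂ))
    (ha : ∀ i i', ∑ x, star (a i x) * a i' x = if i = i' then (1 : ℂ) else 0)
    (j₁ j₂ : Fin q → ℂ)
    (hj₁ : ∑ x, ‖j₁ x‖ ^ 2 = 1) (hj₂ : ∑ x, ‖j₂ x‖ ^ 2 = 1)
    (U : Matrix (Fin p × Fin q) (Fin p × Fin q) ℂ)
    (hU : U ∈ Matrix.unitaryGroup (Fin p × Fin q) ℂ)
    (hsec : ptraceB (outerProj (loOutput U a j₁)) = ptraceB (outerProj (loOutput U a j₂))) :
    ∃ V ∈ Matrix.unitaryGroup (Fin q) ℂ,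
      ((1 : Matrix (Fin n × Fin p) (Fin n × Fin p) ℂ) ⊗ₖ V).mulVec (loOutput U a j₁) =
        loOutput U a j₂ ∧
      ∀ i : Fin n,
        ((1 : Matrix (Fin p) (Fin p) ℂ) ⊗ₖ V).mulVec (U.mulVec (tensorVec (a i) j₁)) =
          U.mulVec (tensorVec (a i) j₂) := by
  obtain ⟨V, hV, hVo⟩ := exists_unitary_of_ptraceB_eq _ _ hsec
  refine ⟨V, hV, hVo, fun i => ?_⟩
  ext ⟨x, c⟩
  have hn0 : (1 / (Real.sqrt (n : ℝ) : ℂ)) ≠ 0 := by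
    have : Real.sqrt (n : ℝ) ≠ 0 := (Real.sqrt_pos.2 (by exact_mod_cast hn)).ne'
    exact one_div_ne_zero (by exact_mod_cast this)
  have h := congrFun hVo ((i, x), c)
  rw [one_kronecker_mulVec_apply] at h
  rw [one_kronecker_mulVec_apply]
  refine mul_left_cancel₀ hn0 (Eq.trans ?_ h)
  exact (congrFun (Matrix.mulVec_smul V (1 / (Real.sqrt (n : ℝ) : ℂ))
    fun c' => U.mulVec (tensorVec (a i) j₁) (x, c')) c).symm
end

section
/- With Alice's registers in the uniform superposition and Bob's input c = 0, the O-OT gate produces exactly the state G[(1/2)(|00⟩+|01⟩+|10⟩+|11⟩)_{A1A2} ⊗ |Φ+⟩_{T1T2} ⊗ |0⟩_{T3} ⊗ |0⟩_B] = (1/(2√2))[(|000⟩_A+|010⟩_A)⊗|000⟩_B + (|001⟩_A−|011⟩_A)⊗|110⟩_B + (|100⟩_A+|110⟩_A)⊗|100⟩_B + (|101⟩_A−|111⟩_A)⊗|010⟩_B], where the A kets list the registers (A1,A2,T1) and the B kets list the registers (T2,T3,B). -/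
open Matrix Kronecker

/-- Index type of the six-qubit state space, listing the registers
`(A1, A2, T1, T2, T3, B)`: `A1, A2` are Alice's inputs, `T1, T2, T3` the
trusted party's qubits J and `B` Bob's input. -/
abbrev Idx6 : Type := Fin 2 × Fin 2 × Fin 2 × Fin 2 × Fin 2 × Fin 2

/-- The computational basis vector `|a1 a2 t1 t2 t3 b⟩`. -/
def ket6 (a1 a2 t1 t2 t3 b : Fin 2) : Idx6 → ℂ :=
  fun x => if x = (a1, a2, t1, t2, t3, b) then 1 else 0

/-- The Pauli matrix `σ_x`. -/
def sigmaX : Matrix (Fin 2) (Fin 2) ℂ := !![0, 1; 1, 0]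

/-- The Pauli matrix `σ_z`. -/
def sigmaZ : Matrix (Fin 2) (Fin 2) ℂ := !![1, 0; 0, -1]

/-- The real matrix `iσ_y = [[0,1],[−1,0]]` (equal to `σ_y` up to a global phase). -/
def iSigmaY : Matrix (Fin 2) (Fin 2) ℂ := !![0, 1; -1, 0]

/-- The rotations `R_{b0 b1}`: `R_00 = I`, `R_01 = σ_z`, `R_10 = σ_x`, `R_11 = iσ_y`. -/
def Rot (b0 b1 : Fin 2) : Matrix (Fin 2) (Fin 2) ℂ :=
  if b0 = 0 then (if b1 = 0 then 1 else sigmaZ)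
  else (if b1 = 0 then sigmaX else iSigmaY)

/-- The single-qubit π/2 rotation about the y-axis,
`R = exp(−i(π/4)σ_y) = (1/√2)[[1,−1],[1,1]]`. -/
noncomputable def Ry : Matrix (Fin 2) (Fin 2) ℂ :=
  (1 / (Real.sqrt 2 : ℂ)) • !![1, -1; 1, 1]

/-- The bilateral π/2 rotation `B_y = R ⊗ R`. -/
noncomputable def By : Matrix (Fin 2 × Fin 2) (Fin 2 × Fin 2) ℂ := Ry ⊗ₖ Ry

/-- Gate (i) of the O-OT gate: the controlled rotation applying `R_{b0 b1}` to
`T1` when `(A1, A2)` hold the basis state `|b0 b1⟩`. -/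
def gate1 : Matrix Idx6 Idx6 ℂ :=
  fun x y =>
    (if x.1 = y.1 then 1 else 0) * (if x.2.1 = y.2.1 then 1 else 0) *
      Rot y.1 y.2.1 x.2.2.1 y.2.2.1 *
      (if x.2.2.2 = y.2.2.2 then 1 else 0)

/-- Gate (ii) of the O-OT gate: the controlled bilateral rotation applying
`B_y` to `(T1, T2)` when `B` holds `|1⟩`. -/
noncomputable def gate2 : Matrix Idx6 Idx6 ℂ :=
  fun x y =>
    (if x.1 = y.1 then 1 else 0) * (if x.2.1 = y.2.1 then 1 else 0) *
      (if x.2.2.2.2.1 = y.2.2.2.2.1 then 1 else 0) *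
      (if x.2.2.2.2.2 = y.2.2.2.2.2 then 1 else 0) *
      (if y.2.2.2.2.2 = 1 then By (x.2.2.1, x.2.2.2.1) (y.2.2.1, y.2.2.2.1)
       else (if x.2.2.1 = y.2.2.1 then 1 else 0) * (if x.2.2.2.1 = y.2.2.2.1 then 1 else 0))

/-- Gate (iii) of the O-OT gate: CNOT with control `T1` and target `T3`. -/
def gate3 : Matrix Idx6 Idx6 ℂ :=
  fun x y =>
    (if x.1 = y.1 then 1 else 0) * (if x.2.1 = y.2.1 then 1 else 0) *
      (if x.2.2.1 = y.2.2.1 then 1 else 0) * (if x.2.2.2.1 = y.2.2.2.1 then 1 else 0) *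
      (if x.2.2.2.2.1 = y.2.2.1 + y.2.2.2.2.1 then 1 else 0) *
      (if x.2.2.2.2.2 = y.2.2.2.2.2 then 1 else 0)

/-- The O-OT gate `G`: first the controlled rotation, then the controlled
bilateral rotation, then the CNOT. -/
noncomputable def ootGate : Matrix Idx6 Idx6 ℂ := gate3 * gate2 * gate1

/-- The input state `(1/2)(|00⟩+|01⟩+|10⟩+|11⟩)_{A1A2} ⊗ |Φ+⟩_{T1T2} ⊗ |0⟩_{T3} ⊗ |c⟩_B`,
written out as `(1/(2√2)) Σ_{a1 a2} (|a1 a2 0 0 0 c⟩ + |a1 a2 1 1 0 c⟩)`. -/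
noncomputable def inState (c : Fin 2) : Idx6 → ℂ :=
  (1 / (2 * (Real.sqrt 2 : ℂ))) •
    (ket6 0 0 0 0 0 c + ket6 0 1 0 0 0 c + ket6 1 0 0 0 0 c + ket6 1 1 0 0 0 c +
     ket6 0 0 1 1 0 c + ket6 0 1 1 1 0 c + ket6 1 0 1 1 0 c + ket6 1 1 1 1 0 c)

/-- The claimed output state for `c = 0`:
`(1/(2√2))[(|000⟩_A+|010⟩_A)⊗|000⟩_B + (|001⟩_A−|011⟩_A)⊗|110⟩_B
  + (|100⟩_A+|110⟩_A)⊗|100⟩_B + (|101⟩_A−|111⟩_A)⊗|010⟩_B]`,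
where the `A` kets list `(A1,A2,T1)` and the `B` kets list `(T2,T3,B)`. -/
noncomputable def outState0 : Idx6 → ℂ :=
  (1 / (2 * (Real.sqrt 2 : ℂ))) •
    ((ket6 0 0 0 0 0 0 + ket6 0 1 0 0 0 0) +
     (ket6 0 0 1 1 1 0 - ket6 0 1 1 1 1 0) +
     (ket6 1 0 0 1 0 0 + ket6 1 1 0 1 0 0) +
     (ket6 1 0 1 0 1 0 - ket6 1 1 1 0 1 0))

theorem mulVec_ket6 (M : Matrix Idx6 Idx6 ℂ) (a1 a2 t1 t2 t3 b : Fin 2) :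
    M.mulVec (ket6 a1 a2 t1 t2 t3 b) = fun x => M x (a1, a2, t1, t2, t3, b) := by
  funext x
  simp only [Matrix.mulVec, dotProduct, ket6, mul_ite, mul_one, mul_zero,
    Finset.sum_ite_eq', Finset.mem_univ, if_true]

theorem gate1_mulVec_ket6 (a1 a2 t1 t2 t3 b : Fin 2) :
    gate1.mulVec (ket6 a1 a2 t1 t2 t3 b) =
      Rot a1 a2 0 t1 • ket6 a1 a2 0 t2 t3 b + Rot a1 a2 1 t1 • ket6 a1 a2 1 t2 t3 b := by
  rw [mulVec_ket6]
  funext ⟨x1, x2, y1, y2, y3, z⟩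
  by_cases h1 : x1 = a1 <;> by_cases h2 : x2 = a2 <;>
    by_cases h3 : (y2, y3, z) = (t2, t3, b) <;> fin_cases y1 <;>
    simp_all [gate1, ket6]

/-- When Bob's register holds `|0⟩` the bilateral rotation is not applied. -/
theorem gate2_mulVec_ket6_zero (a1 a2 t1 t2 t3 : Fin 2) :
    gate2.mulVec (ket6 a1 a2 t1 t2 t3 0) = ket6 a1 a2 t1 t2 t3 0 := by
  rw [mulVec_ket6]
  funext ⟨x1, x2, y1, y2, y3, z⟩
  simp only [gate2, ket6, Prod.mk.injEq, zero_ne_one, if_false, ← ite_and, mul_ite,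
    mul_one, mul_zero]
  split_ifs <;> simp_all

theorem gate3_mulVec_ket6 (a1 a2 t1 t2 t3 b : Fin 2) :
    gate3.mulVec (ket6 a1 a2 t1 t2 t3 b) = ket6 a1 a2 t1 t2 (t1 + t3) b := by
  rw [mulVec_ket6]
  funext ⟨x1, x2, y1, y2, y3, z⟩
  simp only [gate3, ket6, Prod.mk.injEq, mul_ite,
    mul_one, mul_zero]
  split_ifs <;> simp_all

theorem ootGate_mulVec_ket6_zero (a1 a2 t1 t2 t3 : Fin 2) :
    ootGate.mulVec (ket6 a1 a2 t1 t2 t3 0) =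
      Rot a1 a2 0 t1 • ket6 a1 a2 0 t2 t3 0 + Rot a1 a2 1 t1 • ket6 a1 a2 1 t2 (1 + t3) 0 := by
  simp only [ootGate, ← Matrix.mulVec_mulVec, gate1_mulVec_ket6, Matrix.mulVec_add,
    Matrix.mulVec_smul, gate2_mulVec_ket6_zero, gate3_mulVec_ket6, zero_add]

/-- **With Alice's registers in the uniform superposition and Bob's input
`c = 0`, the O-OT gate produces exactly the claimed output state.** -/
theorem ootGate_output_on_uniform_superposition_c0 :
    ootGate.mulVec (inState 0) = outState0 := by
  simp only [inState, outState0, Matrix.mulVec_smul, Matrix.mulVec_add, ootGate_mulVec_ket6_zero]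
  congr 1
  simp [Rot, sigmaX, sigmaZ, iSigmaY]
  abel
end

section
/- Correctness of the O-OT gate on classical inputs: for all b₀, b₁, c ∈ {0,1}, the output state G[|b₀ b₁⟩_{A1A2} ⊗ |Φ+⟩_{T1T2} ⊗ |0⟩_{T3} ⊗ |c⟩_B] is an eigenvector of the observable σ_z^{(T2)} ⊗ σ_z^{(T3)} (σ_z acting on registers T2 and T3, identity elsewhere) with eigenvalue (−1)^{b_c}; equivalently, the output is supported on computational basis states in which the XOR of the bits in registers T2 and T3 equals b_c. Hence Bob, who holds T2 and T3, can learn the chosen bit b_c by measuring both qubits in the computational basis and taking their parity. -/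
open Matrix Kronecker

/-- The classical input state `|b0 b1⟩_{A1A2} ⊗ |Φ+⟩_{T1T2} ⊗ |0⟩_{T3} ⊗ |c⟩_B`. -/
noncomputable def classicalIn (b0 b1 c : Fin 2) : Idx6 → ℂ :=
  (1 / (Real.sqrt 2 : ℂ)) • (ket6 b0 b1 0 0 0 c + ket6 b0 b1 1 1 0 c)

/-- The observable `σ_z^{(T2)} ⊗ σ_z^{(T3)}`: `σ_z` acting on registers `T2`
and `T3`, identity elsewhere. It is diagonal with entry `(−1)^{t2+t3}`. -/
def ZZobs : Matrix Idx6 Idx6 ℂ :=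
  fun x y =>
    if x = y then ((-1 : ℂ) ^ (x.2.2.2.1 : ℕ)) * ((-1 : ℂ) ^ (x.2.2.2.2.1 : ℕ)) else 0

/-- The (unnormalised) state `Σ_{s,u} M_{su} |a1 a2⟩ ⊗ |s u⟩ ⊗ |t3 b⟩`, where the amplitudes of
`(T1, T2)` form the matrix `M`. -/
noncomputable def pairState (M : Matrix (Fin 2) (Fin 2) ℂ) (a1 a2 t3 b : Fin 2) : Idx6 → ℂ :=
  fun x => if x.1 = a1 ∧ x.2.1 = a2 ∧ x.2.2.2.2.1 = t3 ∧ x.2.2.2.2.2 = b then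
    M x.2.2.1 x.2.2.2.1 else 0

/-- The state `Σ_{s,u} M_{su} |a1 a2⟩ ⊗ |s u s⟩ ⊗ |b⟩`, in which `T3` is a copy of `T1`. -/
noncomputable def copiedPairState (M : Matrix (Fin 2) (Fin 2) ℂ) (a1 a2 b : Fin 2) : Idx6 → ℂ :=
  fun x => if x.1 = a1 ∧ x.2.1 = a2 ∧ x.2.2.2.2.1 = x.2.2.1 ∧ x.2.2.2.2.2 = b then
    M x.2.2.1 x.2.2.2.1 else 0

/-- The amplitudes of `(T1, T2)` after the two controlled rotations, up to the factor `1/√2`. -/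
noncomputable def rotatedPair (b0 b1 c : Fin 2) : Matrix (Fin 2) (Fin 2) ℂ :=
  if c = 1 then Ry * Rot b0 b1 * Ryᵀ else Rot b0 b1

lemma classicalIn_eq_pairState (b0 b1 c : Fin 2) :
    classicalIn b0 b1 c = (1 / (Real.sqrt 2 : ℂ)) • pairState 1 b0 b1 0 c := by
  unfold classicalIn
  congr 1
  ext ⟨a1, a2, t1, t2, t3, b⟩
  simp only [ket6, pairState, Pi.add_apply, Prod.mk.injEq, Matrix.one_apply]
  fin_cases t1 <;> fin_cases t2 <;> simp

lemma mulVec_pairState_apply (K : Matrix Idx6 Idx6 ℂ) (M : Matrix (Fin 2) (Fin 2) ℂ)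
    (a1 a2 t3 b : Fin 2) (x : Idx6) :
    K.mulVec (pairState M a1 a2 t3 b) x = ∑ s, ∑ u, K x (a1, a2, s, u, t3, b) * M s u := by
  simp only [mulVec, dotProduct, pairState, Fintype.sum_prod_type]
  rw [Fintype.sum_eq_single a1 (fun y hy => by simp [hy]),
    Fintype.sum_eq_single a2 (fun y hy => by simp [hy])]
  refine Finset.sum_congr rfl fun s _ => Finset.sum_congr rfl fun u _ => ?_
  rw [Fintype.sum_eq_single t3 (fun y hy => by simp [hy]),
    Fintype.sum_eq_single b (fun y hy => by simp [hy])]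
  simp

lemma gate1_mulVec_pairState (M : Matrix (Fin 2) (Fin 2) ℂ) (a1 a2 t3 b : Fin 2) :
    gate1.mulVec (pairState M a1 a2 t3 b) = pairState (Rot a1 a2 * M) a1 a2 t3 b := by
  ext ⟨x1, x2, x3, x4, x5, x6⟩
  rw [mulVec_pairState_apply]
  by_cases h : x1 = a1 ∧ x2 = a2 ∧ x5 = t3 ∧ x6 = b
  · obtain ⟨rfl, rfl, rfl, rfl⟩ := h
    simp [gate1, pairState, Matrix.mul_apply]
  · rw [pairState, if_neg h]
    refine Finset.sum_eq_zero fun s _ => Finset.sum_eq_zero fun u _ => ?_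
    simp only [gate1, Prod.mk.injEq]
    split_ifs <;> first | (exfalso; tauto) | simp

lemma gate2_mulVec_pairState (M : Matrix (Fin 2) (Fin 2) ℂ) (a1 a2 t3 b : Fin 2) :
    gate2.mulVec (pairState M a1 a2 t3 b) =
      pairState (if b = 1 then Ry * M * Ryᵀ else M) a1 a2 t3 b := by
  ext ⟨x1, x2, x3, x4, x5, x6⟩
  rw [mulVec_pairState_apply]
  by_cases h : x1 = a1 ∧ x2 = a2 ∧ x5 = t3 ∧ x6 = b
  · obtain ⟨rfl, rfl, rfl, rfl⟩ := h
    by_cases hb : x6 = 1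
    · simp [gate2, pairState, hb, By, Matrix.mul_apply, Fin.sum_univ_two]
      ring
    · simp [gate2, pairState, hb]
  · rw [pairState, if_neg h]
    refine Finset.sum_eq_zero fun s _ => Finset.sum_eq_zero fun u _ => ?_
    by_cases h1 : x1 = a1
    · by_cases h2 : x2 = a2
      · by_cases h3 : x5 = t3
        · simp [gate2, show x6 ≠ b from fun h4 => h ⟨h1, h2, h3, h4⟩]
        · simp [gate2, h3]
      · simp [gate2, h2]
    · simp [gate2, h1]

lemma gate3_mulVec_pairState (M : Matrix (Fin 2) (Fin 2) ℂ) (a1 a2 b : Fin 2) :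
    gate3.mulVec (pairState M a1 a2 0 b) = copiedPairState M a1 a2 b := by
  ext ⟨x1, x2, x3, x4, x5, x6⟩
  rw [mulVec_pairState_apply, Fintype.sum_eq_single x3 (fun y hy => by simp [gate3, hy.symm]),
    Fintype.sum_eq_single x4 (fun y hy => by simp [gate3, hy.symm])]
  simp only [gate3, copiedPairState]
  split_ifs <;> simp_all

lemma ootGate_mulVec_classicalIn (b0 b1 c : Fin 2) :
    ootGate.mulVec (classicalIn b0 b1 c) =
      (1 / (Real.sqrt 2 : ℂ)) • copiedPairState (rotatedPair b0 b1 c) b0 b1 c := by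
  rw [classicalIn_eq_pairState, Matrix.mulVec_smul, ootGate, ← Matrix.mulVec_mulVec,
    ← Matrix.mulVec_mulVec, gate1_mulVec_pairState, gate2_mulVec_pairState,
    gate3_mulVec_pairState, mul_one, rotatedPair]

lemma Ry_mul_mul_transpose (M : Matrix (Fin 2) (Fin 2) ℂ) :
    Ry * M * Ryᵀ = (1 / 2 : ℂ) • (!![1, -1; 1, 1] * M * !![1, 1; -1, 1]) := by
  have h : (1 / (Real.sqrt 2 : ℂ)) * (1 / (Real.sqrt 2 : ℂ)) = 1 / 2 := by
    rw [div_mul_div_comm, one_mul, ← Complex.ofReal_mul, Real.mul_self_sqrt (by norm_num)]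
    norm_num
  have ht : (!![1, -1; 1, 1] : Matrix (Fin 2) (Fin 2) ℂ)ᵀ = !![1, 1; -1, 1] := by
    ext i j; fin_cases i <;> fin_cases j <;> rfl
  rw [Ry, Matrix.transpose_smul, ht, Matrix.mul_smul, Matrix.smul_mul, Matrix.smul_mul, smul_smul,
    h]

lemma rotatedPair_eq_zero {b0 b1 c s u : Fin 2} (h : s + u ≠ if c = 0 then b0 else b1) :
    rotatedPair b0 b1 c s u = 0 := by
  rw [rotatedPair, Ry_mul_mul_transpose]
  fin_cases b0 <;> fin_cases b1 <;> fin_cases c <;> fin_cases s <;> fin_cases u <;>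
    first
      | exact absurd rfl h
      | simp [Rot, sigmaX, sigmaZ, iSigmaY]

lemma rotatedPair_zero_ne_zero (b0 b1 c : Fin 2) :
    rotatedPair b0 b1 c 0 (if c = 0 then b0 else b1) ≠ 0 := by
  rw [rotatedPair, Ry_mul_mul_transpose]
  fin_cases b0 <;> fin_cases b1 <;> fin_cases c <;>
    norm_num [Rot, sigmaX, sigmaZ, iSigmaY, Matrix.mul_apply, Fin.sum_univ_two]

lemma ZZobs_mulVec_apply (v : Idx6 → ℂ) (x : Idx6) :
    ZZobs.mulVec v x = (-1 : ℂ) ^ ((x.2.2.2.1 : ℕ) + (x.2.2.2.2.1 : ℕ)) * v x := by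
  simp [mulVec, dotProduct, ZZobs, pow_add]

lemma neg_one_pow_val_add (s u : Fin 2) :
    (-1 : ℂ) ^ ((u : ℕ) + (s : ℕ)) = (-1 : ℂ) ^ ((s + u : Fin 2) : ℕ) := by
  fin_cases s <;> fin_cases u <;> simp

/-- **Correctness of the O-OT gate on classical inputs:** for all
`b₀, b₁, c ∈ {0,1}`, the output state
`G[|b₀ b₁⟩_{A1A2} ⊗ |Φ+⟩_{T1T2} ⊗ |0⟩_{T3} ⊗ |c⟩_B]` is an eigenvector of
`σ_z^{(T2)} ⊗ σ_z^{(T3)}` with eigenvalue `(−1)^{b_c}`; hence Bob, who holds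
`T2` and `T3`, can learn the chosen bit `b_c` by measuring both qubits in the
computational basis and taking their parity. -/
theorem ootGate_correct_on_classical_inputs :
    ∀ b0 b1 c : Fin 2,
      ootGate.mulVec (classicalIn b0 b1 c) ≠ 0 ∧
      ZZobs.mulVec (ootGate.mulVec (classicalIn b0 b1 c)) =
        ((-1 : ℂ) ^ (((if c = 0 then b0 else b1) : Fin 2) : ℕ)) •
          ootGate.mulVec (classicalIn b0 b1 c) := by
  intro b0 b1 c
  rw [ootGate_mulVec_classicalIn]
  refine ⟨smul_ne_zero (by simp) fun h => rotatedPair_zero_ne_zero b0 b1 c ?_, ?_⟩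
  · simpa [copiedPairState] using
      congrFun h (b0, b1, 0, (if c = 0 then b0 else b1), 0, c)
  · rw [Matrix.mulVec_smul, smul_comm]
    congr 1
    ext ⟨x1, x2, x3, x4, x5, x6⟩
    rw [ZZobs_mulVec_apply, Pi.smul_apply, smul_eq_mul]
    by_cases hx : x1 = b0 ∧ x2 = b1 ∧ x5 = x3 ∧ x6 = c
    · obtain ⟨rfl, rfl, rfl, rfl⟩ := hx
      by_cases hp : x5 + x4 = if x6 = 0 then x1 else x2
      · rw [← hp, neg_one_pow_val_add]
      · simp [copiedPairState, rotatedPair_eq_zero hp]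
    · simp [copiedPairState, hx]
end

section
/- Extension of Lo's no-go theorem with a pure-state quantum trusted third party (kernel of Theorem 2): let H_A, H_B, H_{A'}, H_{B'} be finite-dimensional complex Hilbert spaces, n ≥ 1, (e_i)_{i=1}^n the standard orthonormal basis of ℂⁿ, (a_i)_{i=1}^n an orthonormal family in H_A, j₁, j₂ unit vectors in H_B, w a unit vector in H_{A'} ⊗ H_{B'} (the trusted party's pure local input, whose output registers H_{A'} and H_{B'} are handed to Alice and Bob respectively), and U a unitary on H_A ⊗ H_B ⊗ H_{A'} ⊗ H_{B'}. Define v_j = (1/√n) Σ_{i=1}^n e_i ⊗ U(a_i ⊗ j ⊗ w). If Tr over Bob's side H_B ⊗ H_{B'} of |v_{j₁}⟩⟨v_{j₁}| equals that of |v_{j₂}⟩⟨v_{j₂}| as operators on Alice's side ℂⁿ ⊗ H_A ⊗ H_{A'}, then there exists a unitary V acting only on Bob's side H_B ⊗ H_{B'} such that (id ⊗ V)v_{j₁} = v_{j₂}, and for every i ∈ {1,…,n}, applying this V to U(a_i ⊗ j₁ ⊗ w) gives U(a_i ⊗ j₂ ⊗ w). -/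
open Matrix

variable {n p q pT qT : ℕ}

/-- The elementary tensor `u ⊗ j ⊗ w` of Alice's input `u ∈ H_A`, Bob's input
`j ∈ H_B` and the trusted party's pure local input `w ∈ H_{A'} ⊗ H_{B'}`,
as a vector of `H_A ⊗ H_B ⊗ H_{A'} ⊗ H_{B'}`. -/
noncomputable def tensAJW (u : Fin p → ℂ) (j : Fin q → ℂ) (w : Fin pT × Fin qT → ℂ) :
    Fin p × Fin q × Fin pT × Fin qT → ℂ :=
  fun z => u z.1 * j z.2.1 * w z.2.2

/-- The global output `v_j = (1/√n) Σ_i e_i ⊗ U(a_i ⊗ j ⊗ w)` of a one-sided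
computation run with the help of a pure-state quantum trusted third party,
in which Alice entangles her input register with a private dice register `ℂⁿ`.
It lives in `ℂⁿ ⊗ H_A ⊗ H_B ⊗ H_{A'} ⊗ H_{B'}`. -/
noncomputable def loTPOutput
    (U : Matrix (Fin p × Fin q × Fin pT × Fin qT) (Fin p × Fin q × Fin pT × Fin qT) ℂ)
    (a : Fin n → (Fin p → ℂ)) (w : Fin pT × Fin qT → ℂ) (j : Fin q → ℂ) :
    Fin n × Fin p × Fin q × Fin pT × Fin qT → ℂ :=
  fun x => (1 / (Real.sqrt (n : ℝ) : ℂ)) * U.mulVec (tensAJW (a x.1) j w) x.2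

/-- The partial trace over Bob's side `H_B ⊗ H_{B'}`, yielding an operator on
Alice's side `ℂⁿ ⊗ H_A ⊗ H_{A'}`. -/
noncomputable def ptraceBobSide
    (ρ : Matrix (Fin n × Fin p × Fin q × Fin pT × Fin qT)
      (Fin n × Fin p × Fin q × Fin pT × Fin qT) ℂ) :
    Matrix (Fin n × Fin p × Fin pT) (Fin n × Fin p × Fin pT) ℂ :=
  fun u u' => ∑ b : Fin q, ∑ b' : Fin qT,
    ρ (u.1, u.2.1, b, u.2.2, b') (u'.1, u'.2.1, b, u'.2.2, b')

/-- The action of an operator `V` on Bob's side `H_B ⊗ H_{B'}` of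
`ℂⁿ ⊗ H_A ⊗ H_B ⊗ H_{A'} ⊗ H_{B'}` (identity on `ℂⁿ ⊗ H_A ⊗ H_{A'}`). -/
noncomputable def applyBob5 (V : Matrix (Fin q × Fin qT) (Fin q × Fin qT) ℂ)
    (ψ : Fin n × Fin p × Fin q × Fin pT × Fin qT → ℂ) :
    Fin n × Fin p × Fin q × Fin pT × Fin qT → ℂ :=
  fun x => ∑ y : Fin q × Fin qT,
    V (x.2.2.1, x.2.2.2.2) y * ψ (x.1, x.2.1, y.1, x.2.2.2.1, y.2)

/-- The action of an operator `V` on Bob's side `H_B ⊗ H_{B'}` of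
`H_A ⊗ H_B ⊗ H_{A'} ⊗ H_{B'}` (identity on `H_A ⊗ H_{A'}`). -/
noncomputable def applyBob4 (V : Matrix (Fin q × Fin qT) (Fin q × Fin qT) ℂ)
    (φ : Fin p × Fin q × Fin pT × Fin qT → ℂ) :
    Fin p × Fin q × Fin pT × Fin qT → ℂ :=
  fun z => ∑ y : Fin q × Fin qT,
    V (z.2.1, z.2.2.2) y * φ (z.1, y.1, z.2.2.1, y.2)

/-- Two finite families of vectors with the same Gram matrix are related by a linear isometry of
the ambient space. -/
theorem LinearIsometry.exists_map_eq_of_gram_eq {𝕜 E ι : Type*} [RCLike 𝕜]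
    [NormedAddCommGroup E] [InnerProductSpace 𝕜 E] [FiniteDimensional 𝕜 E] [Fintype ι]
    {x y : ι → E} (h : gram 𝕜 x = gram 𝕜 y) :
    ∃ T : E →ₗᵢ[𝕜] E, ∀ i, T (x i) = y i := by
  classical
  let f := Fintype.linearCombination 𝕜 x
  let g := Fintype.linearCombination 𝕜 y
  have hinner (c d : ι → 𝕜) : inner 𝕜 (g c) (g d) = inner 𝕜 (f c) (f d) := by
    simp only [f, g, Fintype.linearCombination_apply, ← star_dotProduct_gram_mulVec, h]
  have hker : LinearMap.ker f ≤ LinearMap.ker g := fun c hc => by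
    rw [LinearMap.mem_ker] at hc ⊢
    rw [← inner_self_eq_zero (𝕜 := 𝕜), hinner, hc, inner_zero_left]
  let L₀ : LinearMap.range f →ₗ[𝕜] E :=
    (LinearMap.ker f).liftQ g hker ∘ₗ f.quotKerEquivRange.symm.toLinearMap
  have hL₀ (c : ι → 𝕜) : L₀ ⟨f c, c, rfl⟩ = g c :=
    congrArg ((LinearMap.ker f).liftQ g hker) (f.quotKerEquivRange_symm_apply_image c ⟨c, rfl⟩)
  let L : LinearMap.range f →ₗᵢ[𝕜] E := L₀.isometryOfInner <| by
    rintro ⟨_, c, rfl⟩ ⟨_, d, rfl⟩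
    rw [hL₀, hL₀, hinner]
    rfl
  refine ⟨L.extend, fun i => ?_⟩
  have hf : f (Pi.single i 1) = x i := by simp [f]
  have hg : g (Pi.single i 1) = y i := by simp [g]
  rw [← hf, ← hg, ← hL₀]
  exact L.extend_apply ⟨f (Pi.single i 1), Pi.single i 1, rfl⟩

/-- If `X Xᴴ = Y Yᴴ` then a single unitary maps each row of `X` to the corresponding row of `Y`. -/
theorem Matrix.exists_unitary_mulVec_eq_of_mul_conjTranspose_eq {ι κ : Type*} [Fintype ι]
    [Fintype κ] [DecidableEq κ] {X Y : Matrix ι κ ℂ} (h : X * Xᴴ = Y * Yᴴ) :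
    ∃ V ∈ unitaryGroup κ ℂ, ∀ i, V *ᵥ X i = Y i := by
  have hgram : gram ℂ (fun i => WithLp.toLp 2 (X i)) = gram ℂ (fun i => WithLp.toLp 2 (Y i)) := by
    ext i k
    have := congrFun (congrFun h k) i
    simpa [gram_apply, PiLp.inner_apply, mul_apply, mul_comm] using this
  obtain ⟨T, hT⟩ := LinearIsometry.exists_map_eq_of_gram_eq hgram
  refine ⟨of fun r c => T (EuclideanSpace.single c 1) r, ?_, fun i => ?_⟩
  · rw [mem_unitaryGroup_iff']
    ext c d
    have := T.inner_map_map (EuclideanSpace.single c 1) (EuclideanSpace.single d 1)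
    rw [PiLp.inner_apply, EuclideanSpace.inner_single_left] at this
    simpa [mul_apply, one_apply, mul_comm, eq_comm] using this
  · have hX : WithLp.toLp 2 (X i) = ∑ c, X i c • EuclideanSpace.single c (1 : ℂ) := by
      ext r
      simp [Pi.single_apply]
    ext r
    have := congrArg (fun v => v r) (hT i)
    simp only [hX, map_sum, map_smul] at this
    simpa [mulVec, dotProduct, mul_comm] using this

/-- **Extension of Lo's no-go theorem with a pure-state quantum trusted third
party (kernel of Theorem 2 of the paper):** if the reduced states on Alice's
side `ℂⁿ ⊗ H_A ⊗ H_{A'}` of the outputs `v_{j₁}` and `v_{j₂}` agree, then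
there is a unitary `V` acting only on Bob's side `H_B ⊗ H_{B'}` with
`(id ⊗ V) v_{j₁} = v_{j₂}`, and applying this `V` to `U(a_i ⊗ j₁ ⊗ w)` gives
`U(a_i ⊗ j₂ ⊗ w)` for every `i`. -/
theorem lo_no_go_with_trusted_third_party (n p q pT qT : ℕ) (hn : 1 ≤ n)
    (a : Fin n → (Fin p → ℂ))
    (ha : ∀ i i', ∑ x, star (a i x) * a i' x = if i = i' then (1 : ℂ) else 0)
    (j₁ j₂ : Fin q → ℂ)
    (hj₁ : ∑ x, ‖j₁ x‖ ^ 2 = 1) (hj₂ : ∑ x, ‖j₂ x‖ ^ 2 = 1)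
    (w : Fin pT × Fin qT → ℂ) (hw : ∑ x, ‖w x‖ ^ 2 = 1)
    (U : Matrix (Fin p × Fin q × Fin pT × Fin qT) (Fin p × Fin q × Fin pT × Fin qT) ℂ)
    (hU : U ∈ Matrix.unitaryGroup (Fin p × Fin q × Fin pT × Fin qT) ℂ)
    (hsec : ptraceBobSide (outerProj (loTPOutput U a w j₁)) =
      ptraceBobSide (outerProj (loTPOutput U a w j₂))) :
    ∃ V ∈ Matrix.unitaryGroup (Fin q × Fin qT) ℂ,
      applyBob5 V (loTPOutput U a w j₁) = loTPOutput U a w j₂ ∧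
      ∀ i : Fin n,
        applyBob4 V (U.mulVec (tensAJW (a i) j₁ w)) =
          U.mulVec (tensAJW (a i) j₂ w) := by
  let M (j : Fin q → ℂ) : Matrix (Fin n × Fin p × Fin pT) (Fin q × Fin qT) ℂ :=
    of fun u b => loTPOutput U a w j (u.1, u.2.1, b.1, u.2.2, b.2)
  have hM (j : Fin q → ℂ) :
      M j * (M j)ᴴ = ptraceBobSide (outerProj (loTPOutput U a w j)) := by
    ext u u'
    simp [M, mul_apply, ptraceBobSide, outerProj, Fintype.sum_prod_type]
  obtain ⟨V, hV, hVM⟩ := exists_unitary_mulVec_eq_of_mul_conjTranspose_eq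
    ((hM j₁).trans (hsec.trans (hM j₂).symm))
  have h5 : applyBob5 V (loTPOutput U a w j₁) = loTPOutput U a w j₂ := by
    ext ⟨i, s, b, t, b'⟩
    exact congrFun (hVM (i, s, t)) (b, b')
  refine ⟨V, hV, h5, fun i => ?_⟩
  have hc : (1 / (Real.sqrt (n : ℝ) : ℂ)) ≠ 0 := by
    have : Real.sqrt (n : ℝ) ≠ 0 := by positivity
    simpa using this
  ext z
  refine mul_left_cancel₀ hc (Eq.trans ?_ (congrFun h5 (i, z)))
  simp only [applyBob4, applyBob5, loTPOutput, Finset.mul_sum]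
  exact Finset.sum_congr rfl fun y _ => by ring
end
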